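/- Let d ≥ 1 and let z, z', w ∈ ℝ^d with z ≠ w and z' ≠ w. Then ∫_{S^{d−1}} | 1(⟨β,z⟩ ≤ ⟨β,w⟩) − 1(⟨β,z'⟩ ≤ ⟨β,w⟩) | dλ(β) = (1/π)·Ang(z − w, z' − w). -/

import Mathlib

open MeasureTheory ProbabilityTheory Real
open scoped RealInnerProductSpace ENNReal BigOperators

noncomputable section

/-- The standard Gaussian measure on `ℝ^d = EuclideanSpace ℝ (Fin d)`. -/
def stdGaussian (d : ℕ) : Measure (EuclideanSpace ℝ (Fin d)) :=
  (Measure.pi fun _ : Fin d => gaussianReal 0 1).map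
    ⇑(EuclideanSpace.equiv (Fin d) ℝ).symm

/-- The uniform (rotation-invariant) probability measure `λ` on the unit sphere
`S^{d-1} = {x : ‖x‖ = 1} ⊆ ℝ^d`, realized as a Borel measure on `ℝ^d` concentrated
on the sphere: the pushforward of the standard Gaussian under `x ↦ ‖x‖⁻¹ • x`. -/
def sphereUniform (d : ℕ) : Measure (EuclideanSpace ℝ (Fin d)) :=
  (stdGaussian d).map fun x => ‖x‖⁻¹ • x

/-- `Ang u v = arccos (⟪u,v⟫ / (‖u‖ ‖v‖)) ∈ [0, π]`, the angle between two nonzero vectors. -/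
def Ang {d : ℕ} (u v : EuclideanSpace ℝ (Fin d)) : ℝ :=
  Real.arccos (⟪u, v⟫ / (‖u‖ * ‖v‖))

/-- The two-dimensional "disagreement" function. -/
def disag (a b : ℝ) : ℝ :=
  |(if a ≤ 0 then (1 : ℝ) else 0) - (if b ≤ 0 then (1 : ℝ) else 0)|

lemma disag_meas : Measurable (fun p : ℝ × ℝ => disag p.1 p.2) := by
  unfold disag
  have h1 : MeasurableSet {p : ℝ × ℝ | p.1 ≤ 0} := measurableSet_le measurable_fst measurable_const
  have h2 : MeasurableSet {p : ℝ × ℝ | p.2 ≤ 0} := measurableSet_le measurable_snd measurable_const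
  have h3 : Measurable fun p : ℝ × ℝ => if p.1 ≤ 0 then (1 : ℝ) else 0 :=
    Measurable.ite h1 measurable_const measurable_const
  have h4 : Measurable fun p : ℝ × ℝ => if p.2 ≤ 0 then (1 : ℝ) else 0 :=
    Measurable.ite h2 measurable_const measurable_const
  exact (h3.sub h4).abs

lemma disag_smul {r : ℝ} (hr : 0 < r) (a b : ℝ) : disag (r * a) (r * b) = disag a b := by
  have h : ∀ x : ℝ, r * x ≤ 0 ↔ x ≤ 0 := fun x => by
    constructor
    · intro h; by_contra! h'; nlinarith [mul_pos hr h']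
    · intro h; exact mul_nonpos_of_nonneg_of_nonpos hr.le h
  simp only [disag, h]

lemma disag_abs_le (a b : ℝ) : ‖disag a b‖ ≤ 1 := by
  unfold disag
  split_ifs <;> simp

/-- Homogeneous functions of a planar standard Gaussian. -/
lemma gauss_polar : ∃ C : ℝ, ∀ f : ℝ × ℝ → ℝ,
    (∀ r a b : ℝ, 0 < r → f (r * a, r * b) = f (a, b)) →
    ∫ p, f p ∂((gaussianReal 0 1).prod (gaussianReal 0 1))
      = C * ∫ t in Set.Ioo (-π) π, f (cos t, sin t) := by
  refine ⟨∫ r in Set.Ioi (0 : ℝ), r * ((2 * π)⁻¹ * exp (-(r ^ 2) / 2)), fun f hf => ?_⟩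
  rw [gaussianReal_of_var_ne_zero 0 one_ne_zero,
    prod_withDensity (measurable_gaussianPDF 0 1) (measurable_gaussianPDF 0 1),
    integral_withDensity_eq_integral_toReal_smul
      (f := fun z : ℝ × ℝ => gaussianPDF 0 1 z.1 * gaussianPDF 0 1 z.2)
      (((measurable_gaussianPDF 0 1).comp measurable_fst).mul
        ((measurable_gaussianPDF 0 1).comp measurable_snd))
      (Filter.Eventually.of_forall fun p => ENNReal.mul_lt_top gaussianPDF_lt_top gaussianPDF_lt_top)]
  rw [← Measure.volume_eq_prod, ← integral_comp_polarCoord_symm, ← setIntegral_prod_mul,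
    ← Measure.volume_eq_prod]
  refine setIntegral_congr_fun polarCoord.open_target.measurableSet ?_
  rintro ⟨r, t⟩ hp
  have hr : 0 < r := by
    have := hp.1
    exact this
  simp only [polarCoord_symm_apply, ENNReal.toReal_mul, toReal_gaussianPDF, smul_eq_mul, hf r _ _ hr,
    gaussianPDFReal_def]
  have h2 : (√(2 * π)) * √(2 * π) = 2 * π := Real.mul_self_sqrt (by positivity)
  have h3 : exp (-(r * cos t) ^ 2 / 2) * exp (-(r * sin t) ^ 2 / 2) = exp (-(r ^ 2) / 2) := by
    rw [← exp_add]
    congr 1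
    have := sin_sq_add_cos_sq t
    linear_combination (-(r ^ 2) / 2) * this
  have h4 : (2 * π)⁻¹ = (√(2 * π))⁻¹ * (√(2 * π))⁻¹ := by rw [← mul_inv, h2]
  rw [← h3, h4]
  simp only [sub_zero, NNReal.coe_one, mul_one]
  ring

lemma gauss_polar' (f : ℝ × ℝ → ℝ)
    (hf : ∀ r a b : ℝ, 0 < r → f (r * a, r * b) = f (a, b)) :
    ∫ p, f p ∂((gaussianReal 0 1).prod (gaussianReal 0 1))
      = (2 * π)⁻¹ * ∫ t in Set.Ioo (-π) π, f (cos t, sin t) := by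
  obtain ⟨C, hC⟩ := gauss_polar
  have h1 := hC (fun _ => 1) (by simp)
  have h2 : ∫ t in Set.Ioo (-π) π, (1 : ℝ) = 2 * π := by
    simp [Measure.real, pi_pos.le]
    ring
  rw [h2] at h1
  simp only [integral_const, probReal_univ, smul_eq_mul, mul_one] at h1
  rw [hC f hf]
  congr 1
  exact eq_inv_of_mul_eq_one_left h1.symm

lemma disag_pos_pos {a b : ℝ} (ha : 0 < a) (hb : 0 < b) : disag a b = 0 := by
  simp [disag, ha.not_ge, hb.not_ge]
lemma disag_neg_neg {a b : ℝ} (ha : a ≤ 0) (hb : b ≤ 0) : disag a b = 0 := by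
  simp [disag, ha, hb]
lemma disag_pos_neg {a b : ℝ} (ha : 0 < a) (hb : b ≤ 0) : disag a b = 1 := by
  simp [disag, ha.not_ge, hb]
lemma disag_neg_pos {a b : ℝ} (ha : a ≤ 0) (hb : 0 < b) : disag a b = 1 := by
  simp [disag, ha, hb.not_ge]

lemma integral_const_of_Ioo (f : ℝ → ℝ) {a b c : ℝ} (hab : a ≤ b)
    (h : ∀ t ∈ Set.Ioo a b, f t = c) : ∫ t in a..b, f t = (b - a) * c := by
  rw [intervalIntegral.integral_of_le hab, integral_Ioc_eq_integral_Ioo,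
    setIntegral_congr_fun measurableSet_Ioo h]
  simp [Measure.real, hab]

lemma circle_int {θ : ℝ} (h0 : 0 ≤ θ) (hπ : θ ≤ π) :
    ∫ t in Set.Ioo (-π) π, disag (cos t) (cos (t - θ)) = 2 * θ := by
  set g : ℝ → ℝ := fun t => disag (cos t) (cos (t - θ)) with hg
  have hpi := pi_pos
  have hper : Function.Periodic g (2 * π) := by
    intro t
    simp only [hg, add_sub_right_comm, cos_add_two_pi]
  have hgm : Measurable g :=
    disag_meas.comp (f := fun t : ℝ => (cos t, cos (t - θ))) (by fun_prop)
  have hint : ∀ a b, IntervalIntegrable g volume a b := fun a b => by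
    rw [intervalIntegrable_iff]
    exact Measure.integrableOn_of_bounded (M := 1) (by simp) hgm.aestronglyMeasurable
      (Filter.Eventually.of_forall fun t => disag_abs_le _ _)
  rw [← integral_Ioc_eq_integral_Ioo, ← intervalIntegral.integral_of_le (by linarith)]
  have e1 := hper.intervalIntegral_add_eq (-π) (-(π / 2))
  rw [show -π + 2 * π = π by ring] at e1
  have i1 : ∫ t in (-(π / 2))..(θ - π / 2), g t = (θ - π / 2 - (-(π / 2))) * 1 := by
    refine integral_const_of_Ioo g (by linarith) fun t ht => disag_pos_neg ?_ ?_
    · exact cos_pos_of_mem_Ioo ⟨by linarith [ht.1], by linarith [ht.2]⟩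
    · rw [← cos_neg]
      exact cos_nonpos_of_pi_div_two_le_of_le (by linarith [ht.2]) (by linarith [ht.1])
  have i2 : ∫ t in (θ - π / 2)..(π / 2), g t = (π / 2 - (θ - π / 2)) * 0 := by
    refine integral_const_of_Ioo g (by linarith) fun t ht => disag_pos_pos ?_ ?_
    · exact cos_pos_of_mem_Ioo ⟨by linarith [ht.1], by linarith [ht.2]⟩
    · exact cos_pos_of_mem_Ioo ⟨by linarith [ht.1], by linarith [ht.2]⟩
  have i3 : ∫ t in (π / 2)..(θ + π / 2), g t = (θ + π / 2 - (π / 2)) * 1 := by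
    refine integral_const_of_Ioo g (by linarith) fun t ht => disag_neg_pos ?_ ?_
    · exact cos_nonpos_of_pi_div_two_le_of_le (by linarith [ht.1]) (by linarith [ht.2])
    · exact cos_pos_of_mem_Ioo ⟨by linarith [ht.1], by linarith [ht.2]⟩
  have i4 : ∫ t in (θ + π / 2)..(-(π / 2) + 2 * π), g t
      = (-(π / 2) + 2 * π - (θ + π / 2)) * 0 := by
    refine integral_const_of_Ioo g (by linarith) fun t ht => disag_neg_neg ?_ ?_
    · exact cos_nonpos_of_pi_div_two_le_of_le (by linarith [ht.1]) (by linarith [ht.2])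
    · exact cos_nonpos_of_pi_div_two_le_of_le (by linarith [ht.1]) (by linarith [ht.2])
  rw [e1, ← intervalIntegral.integral_add_adjacent_intervals (hint _ (θ + π / 2)) (hint _ _),
    ← intervalIntegral.integral_add_adjacent_intervals (hint _ (π / 2)) (hint _ _),
    ← intervalIntegral.integral_add_adjacent_intervals (hint _ (θ - π / 2)) (hint _ _),
    i1, i2, i3, i4]
  ring

lemma stdGaussian_eq (d : ℕ) :
    _root_.stdGaussian d = ProbabilityTheory.stdGaussian (EuclideanSpace ℝ (Fin d)) := by
  rw [← map_pi_eq_stdGaussian]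
  rfl

/-- The joint law of two unit projections of a standard Gaussian. -/
lemma joint_law {d : ℕ} (u v : EuclideanSpace ℝ (Fin d)) (hu : ‖u‖ = 1) (hv : ‖v‖ = 1)
    (θ : ℝ) (hθ : ⟪u, v⟫ = cos θ) :
    (_root_.stdGaussian d).map (fun x => (⟪u, x⟫, ⟪v, x⟫))
      = ((gaussianReal 0 1).prod (gaussianReal 0 1)).map
        (fun p : ℝ × ℝ => (p.1, cos θ * p.1 + sin θ * p.2)) := by
  rw [stdGaussian_eq]
  let A : EuclideanSpace ℝ (Fin d) →L[ℝ] ℝ × ℝ := (innerSL ℝ u).prod (innerSL ℝ v)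
  let B : ℝ × ℝ →L[ℝ] ℝ × ℝ := (ContinuousLinearMap.fst ℝ ℝ ℝ).prod
    (cos θ • ContinuousLinearMap.fst ℝ ℝ ℝ + sin θ • ContinuousLinearMap.snd ℝ ℝ ℝ)
  change Measure.map A _ = Measure.map B _
  have : IsProbabilityMeasure (Measure.map A (ProbabilityTheory.stdGaussian (EuclideanSpace ℝ (Fin d)))) :=
    Measure.isProbabilityMeasure_map (by fun_prop)
  have : IsProbabilityMeasure (Measure.map B ((gaussianReal 0 1).prod (gaussianReal 0 1))) :=
    Measure.isProbabilityMeasure_map (by fun_prop)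
  apply Measure.ext_of_charFunDual
  funext L
  rw [charFunDual_map, charFunDual_map, charFunDual_prod]
  set s := L (1, 0) with hs
  set t := L (0, 1) with ht
  have hL : ∀ a b : ℝ, L (a, b) = a * s + b * t := by
    intro a b
    have : ((a, b) : ℝ × ℝ) = a • (1, 0) + b • (0, 1) := by ext <;> simp
    rw [this, map_add, map_smul, map_smul]; simp [hs, ht]
  have hA : L.comp A = InnerProductSpace.toDualMap ℝ _ (s • u + t • v) := by
    ext x
    simp [A, hL]
    ring
  have hB1 : (L.comp B).comp (.inl ℝ ℝ ℝ) = InnerProductSpace.toDualMap ℝ _ (s + cos θ * t) := by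
    ext
    simp [B, hL]
  have hB2 : (L.comp B).comp (.inr ℝ ℝ ℝ) = InnerProductSpace.toDualMap ℝ _ (sin θ * t) := by
    ext
    simp [B, hL]
  rw [hA, hB1, hB2, ← charFun_eq_charFunDual_toDualMap, ← charFun_eq_charFunDual_toDualMap,
    ← charFun_eq_charFunDual_toDualMap, charFun_stdGaussian, charFun_gaussianReal,
    charFun_gaussianReal, ← Complex.exp_add]
  congr 1
  have hn : ‖s • u + t • v‖ ^ 2 = (s + cos θ * t) ^ 2 + (sin θ * t) ^ 2 := by
    rw [norm_add_sq_real, norm_smul, norm_smul, hu, hv, inner_smul_left, inner_smul_right, hθ]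
    simp only [mul_one, norm_eq_abs, sq_abs, conj_trivial]
    linear_combination (-t ^ 2) * sin_sq_add_cos_sq θ
  have hn' : ((‖s • u + t • v‖ : ℂ)) ^ 2 = ((s + cos θ * t : ℝ) : ℂ) ^ 2 + ((sin θ * t : ℝ) : ℂ) ^ 2 := by
    exact_mod_cast hn
  rw [hn']
  simp
  ring

/-- for `d ≥ 1` and `z ≠ w`, `z' ≠ w`,
`∫_{S^{d-1}} |1(⟪β,z⟫ ≤ ⟪β,w⟫) - 1(⟪β,z'⟫ ≤ ⟪β,w⟫)| dλ(β) = Ang(z-w, z'-w)/π`. -/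
theorem stmt11 {d : ℕ} (hd : 1 ≤ d) (z z' w : EuclideanSpace ℝ (Fin d))
    (h1 : z ≠ w) (h2 : z' ≠ w) :
    (∫ β, |(if ⟪β, z⟫ ≤ ⟪β, w⟫ then (1 : ℝ) else 0)
        - (if ⟪β, z'⟫ ≤ ⟪β, w⟫ then (1 : ℝ) else 0)| ∂(sphereUniform d))
      = (1 / π) * Ang (z - w) (z' - w) := by
  have hz : 0 < ‖z - w‖ := norm_pos_iff.2 (sub_ne_zero.2 h1)
  have hz' : 0 < ‖z' - w‖ := norm_pos_iff.2 (sub_ne_zero.2 h2)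
  set θ := Ang (z - w) (z' - w) with hθ
  set u := ‖z - w‖⁻¹ • (z - w) with hu
  set v := ‖z' - w‖⁻¹ • (z' - w) with hv
  have hu1 : ‖u‖ = 1 := by rw [hu, norm_smul, norm_inv, norm_norm, inv_mul_cancel₀ hz.ne']
  have hv1 : ‖v‖ = 1 := by rw [hv, norm_smul, norm_inv, norm_norm, inv_mul_cancel₀ hz'.ne']
  have huv : ⟪u, v⟫ = cos θ := by
    have := InnerProductGeometry.cos_angle (z - w) (z' - w)
    rw [InnerProductGeometry.angle] at this
    rw [hθ, Ang, this, hu, hv, inner_smul_left, inner_smul_right]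
    simp only [conj_trivial]
    field_simp
  have key : ∀ (a : EuclideanSpace ℝ (Fin d)), 0 < ‖a - w‖ → ∀ β : EuclideanSpace ℝ (Fin d),
      (⟪β, a⟫ ≤ ⟪β, w⟫ ↔ ⟪‖a - w‖⁻¹ • (a - w), β⟫ ≤ 0) := by
    intro a ha β
    rw [real_inner_smul_left, real_inner_comm β (a - w), inner_sub_right]
    have hi : 0 < ‖a - w‖⁻¹ := inv_pos.2 ha
    rw [mul_nonpos_iff_pos_imp_nonpos]
    constructor
    · intro h
      exact ⟨fun _ => by linarith, fun h' => by linarith⟩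
    · intro h
      linarith [h.1 hi]
  have hF : ∀ β : EuclideanSpace ℝ (Fin d), |(if ⟪β, z⟫ ≤ ⟪β, w⟫ then (1 : ℝ) else 0)
        - (if ⟪β, z'⟫ ≤ ⟪β, w⟫ then (1 : ℝ) else 0)| = disag ⟪u, β⟫ ⟪v, β⟫ := by
    intro β
    simp only [key z hz, key z' hz', disag, hu, hv]
  simp only [hF]
  have hpm : Measurable (fun x : EuclideanSpace ℝ (Fin d) => (⟪u, x⟫, ⟪v, x⟫)) :=
    Continuous.measurable (by fun_prop)
  have hFm : Measurable (fun x : EuclideanSpace ℝ (Fin d) => disag ⟪u, x⟫ ⟪v, x⟫) :=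
    disag_meas.comp hpm
  rw [sphereUniform, integral_map (by fun_prop) hFm.aestronglyMeasurable]
  have hhom : ∀ x : EuclideanSpace ℝ (Fin d),
      disag ⟪u, ‖x‖⁻¹ • x⟫ ⟪v, ‖x‖⁻¹ • x⟫ = disag ⟪u, x⟫ ⟪v, x⟫ := by
    intro x
    rcases eq_or_ne x 0 with rfl | hx
    · simp
    · rw [inner_smul_right, inner_smul_right]
      exact disag_smul (inv_pos.2 (norm_pos_iff.2 hx)) _ _
  simp only [hhom]
  have hBm : Measurable (fun p : ℝ × ℝ => (p.1, cos θ * p.1 + sin θ * p.2)) := by fun_prop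
  have e1 := integral_map (μ := _root_.stdGaussian d) hpm.aemeasurable
    (f := fun p : ℝ × ℝ => disag p.1 p.2) disag_meas.aestronglyMeasurable
  have e2 := integral_map (μ := (gaussianReal 0 1).prod (gaussianReal 0 1)) hBm.aemeasurable
    (f := fun p : ℝ × ℝ => disag p.1 p.2) disag_meas.aestronglyMeasurable
  rw [joint_law u v hu1 hv1 θ huv, e2] at e1
  simp only at e1
  rw [← e1, gauss_polar' (fun p => disag p.1 (cos θ * p.1 + sin θ * p.2))]
  · have e3 : ∀ t, cos θ * cos t + sin θ * sin t = cos (t - θ) := fun t => by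
      rw [cos_sub]; ring
    simp only [e3]
    rw [circle_int (θ := θ) (arccos_nonneg _) (arccos_le_pi _)]
    have := pi_pos
    field_simp
  · intro r a b hr
    simp only
    rw [← disag_smul hr a]
    congr 1
    ring
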